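/- Let n_1, n_2, … be a lacunary sequence of positive integers and let ε > 0. Then for Lebesgue almost all β ∈ ℝ, for every δ ∈ ℝ there are infinitely many positive integers t with ‖n_t β − δ‖ < (log t)^(3+ε) / t. -/

import Mathlib

open Real MeasureTheory Set

/-- Distance from `x` to the nearest integer. -/
noncomputable def nint (x : ℝ) : ℝ := ⨅ n : ℤ, |x - n|

/-- The set of badly approximable numbers. -/
def Bad : Set ℝ := {α : ℝ | ∃ c > 0, ∀ n : ℕ, 1 ≤ n → c ≤ n * nint (n * α)}

/-- The set of `δ`-inhomogeneously badly approximable numbers. -/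
def BadShift (δ : ℝ) : Set ℝ := {β : ℝ | ∃ c > 0, ∀ n : ℕ, 1 ≤ n → c ≤ n * nint (n * β - δ)}

/-- The set `ℬ = {(β, δ) : β ∈ Bad ∩ Bad(δ)}`. -/
def calB : Set (ℝ × ℝ) := {p : ℝ × ℝ | p.1 ∈ Bad ∧ p.1 ∈ BadShift p.2}

/-- The `k`-th continuant `q_k(α)` (denominator of the `k`-th convergent) of the
continued fraction expansion of `α`. -/
noncomputable def contDen (α : ℝ) (k : ℕ) : ℝ := (GenContFract.of α).dens k

/-- `Λ(α) = sup_{k ≥ 1} (log q_k(α)) / k`. -/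
noncomputable def Lam (α : ℝ) : ℝ := ⨆ k : ℕ+, Real.log (contDen α k) / k

/-- Membership in the set `𝒦` of irrational numbers with `Λ(α) < ∞`. -/
def memK (α : ℝ) : Prop :=
  Irrational α ∧ BddAbove (Set.range fun k : ℕ+ => Real.log (contDen α k) / k)

/-- The Fourier transform `μ̂(ξ) = ∫ e^{-2πiξx} dμ(x)` of a measure `μ` on `ℝ`. -/
noncomputable def mFT (μ : Measure ℝ) (ξ : ℝ) : ℂ :=
  ∫ x, Complex.exp (-(2 * Real.pi * ξ * x : ℝ) * Complex.I) ∂μ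

/-- Dispersion of a (finite) set `A ⊆ [0,1)`: the largest gap between circularly
consecutive elements, where the gap between the largest and the smallest element
wraps around, i.e. equals `min A + 1 - max A`. -/
noncomputable def disp (A : Set ℝ) : ℝ :=
  sSup {d : ℝ |
    (∃ a ∈ A, ∃ b ∈ A, a < b ∧ (∀ x ∈ A, x ≤ a ∨ b ≤ x) ∧ d = b - a) ∨
    (∃ a ∈ A, ∃ b ∈ A, (∀ x ∈ A, b ≤ x ∧ x ≤ a) ∧ d = b + 1 - a)}

lemma nint_le_abs_sub (x : ℝ) (k : ℤ) : nint x ≤ |x - k| :=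
  ciInf_le ⟨0, by rintro _ ⟨j, rfl⟩; exact abs_nonneg _⟩ k

/-- The points of `[a, b)` whose dilates by `N 0, …, N (m - 1)` all avoid the arc `[c, c + l)`
modulo `1` have measure at most about `(1 - l / 2) ^ m (b - a)`, if `N` grows fast enough. -/
lemma volume_avoid_arc_le (c l : ℝ) (hl : 0 < l) (hl1 : l ≤ 1) (m : ℕ) :
    ∀ (N : ℕ → ℝ), (∀ i, 0 < N i) → (∀ i, 4 / l * N i ≤ N (i + 1)) → ∀ a b : ℝ, a ≤ b →
      volume {x : ℝ | x ∈ Ico a b ∧ ∀ i < m, ∀ k : ℤ, N i * x - k ∉ Ico c (c + l)} ≤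
        ENNReal.ofReal ((b - a + 2 / N 0) * (1 - l / 2) ^ m) := by
  induction m with
  | zero =>
    intro N hN _ a b _
    have h0 := hN 0
    calc _ ≤ volume (Ico a b) := measure_mono fun x hx => hx.1
      _ = ENNReal.ofReal (b - a) := Real.volume_Ico
      _ ≤ _ := ENNReal.ofReal_le_ofReal (by
        have : 0 ≤ 2 / N 0 := by positivity
        simpa using this)
  | succ m ih =>
    intro N hN hQ a b hab
    have h0 := hN 0
    have h1 := hN 1
    have hρ : 0 ≤ 1 - l / 2 := by linarith
    set F : Finset ℤ := Finset.Icc ⌊N 0 * a - c⌋ ⌊N 0 * b - c⌋ with hF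
    set S : ℤ → Set ℝ := fun k => {x : ℝ | x ∈ Ico ((k + c + l) / N 0) ((k + c + 1) / N 0) ∧
      ∀ i < m, ∀ k : ℤ, N (i + 1) * x - k ∉ Ico c (c + l)}
    have hcover : {x : ℝ | x ∈ Ico a b ∧ ∀ i < m + 1, ∀ k : ℤ, N i * x - k ∉ Ico c (c + l)} ⊆
        ⋃ k ∈ F, S k := by
      rintro x ⟨⟨hax, hxb⟩, hx⟩
      have hfl := Int.floor_le (N 0 * x - c)
      have hlt := Int.lt_floor_add_one (N 0 * x - c)
      simp only [mem_iUnion]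
      refine ⟨⌊N 0 * x - c⌋, ?_, ⟨?_, ?_⟩, fun i hi k => hx (i + 1) (by omega) k⟩
      · rw [hF, Finset.mem_Icc]
        constructor <;> apply Int.floor_mono <;> nlinarith
      · have := hx 0 (by omega) ⌊N 0 * x - c⌋
        rw [mem_Ico, not_and, not_lt] at this
        rw [div_le_iff₀ h0]
        linarith [this (by linarith)]
      · rw [lt_div_iff₀ h0]
        linarith
    have hpiece : ∀ k ∈ F, volume (S k) ≤
        ENNReal.ofReal (1 / N 0 * (1 - l / 2) ^ (m + 1)) := by
      intro k _
      refine (ih (fun i => N (i + 1)) (fun i => hN _) (fun i => hQ _) _ _ ?_).trans ?_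
      · gcongr
      · apply ENNReal.ofReal_le_ofReal
        have h2 : 2 / N 1 ≤ l / 2 / N 0 := by
          rw [div_le_div_iff₀ h1 h0]
          have := hQ 0
          rw [div_mul_eq_mul_div, div_le_iff₀ hl] at this
          simp only [zero_add] at this
          linarith
        have h3 : (k + c + 1) / N 0 - (k + c + l) / N 0 + 2 / N 1 ≤ 1 / N 0 * (1 - l / 2) := by
          calc _ ≤ (k + c + 1) / N 0 - (k + c + l) / N 0 + l / 2 / N 0 := by gcongr
            _ = _ := by field_simp; ring
        rw [pow_succ', ← mul_assoc]
        exact mul_le_mul_of_nonneg_right h3 (by positivity)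
    have hcard : (F.card : ℝ) ≤ N 0 * (b - a) + 2 := by
      have hle : ⌊N 0 * a - c⌋ ≤ ⌊N 0 * b - c⌋ := Int.floor_mono (by nlinarith)
      have : (F.card : ℤ) = ⌊N 0 * b - c⌋ + 1 - ⌊N 0 * a - c⌋ := by
        rw [hF, Int.card_Icc]; omega
      have h' : (F.card : ℝ) = ⌊N 0 * b - c⌋ + 1 - ⌊N 0 * a - c⌋ := by exact_mod_cast this
      rw [h']
      linarith [Int.floor_le (N 0 * b - c), Int.lt_floor_add_one (N 0 * a - c)]
    calc _ ≤ volume (⋃ k ∈ F, S k) := measure_mono hcover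
      _ ≤ ∑ k ∈ F, volume (S k) := measure_biUnion_finset_le _ _
      _ ≤ F.card • ENNReal.ofReal (1 / N 0 * (1 - l / 2) ^ (m + 1)) :=
        Finset.sum_le_card_nsmul _ _ _ hpiece
      _ = ENNReal.ofReal (F.card * (1 / N 0 * (1 - l / 2) ^ (m + 1))) := by
        rw [nsmul_eq_mul, ← ENNReal.ofReal_natCast, ← ENNReal.ofReal_mul (by positivity)]
      _ ≤ _ := by
        apply ENNReal.ofReal_le_ofReal
        calc _ ≤ (N 0 * (b - a) + 2) * (1 / N 0 * (1 - l / 2) ^ (m + 1)) := by gcongr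
          _ = _ := by field_simp

/-- Union bound over the `M` arcs `[j / M, (j + 1) / M)`. -/
lemma volume_exists_avoid_arc_le (M m : ℕ) (hM : 0 < M) (N : ℕ → ℝ) (hN : ∀ i, 1 ≤ N i)
    (hQ : ∀ i, 4 * M * N i ≤ N (i + 1)) (a b : ℝ) (hab : a ≤ b) :
    volume {x : ℝ | x ∈ Ico a b ∧ ∃ j < M, ∀ i < m, ∀ k : ℤ,
        N i * x - k ∉ Ico ((j : ℝ) / M) (j / M + 1 / M)} ≤
      ENNReal.ofReal ((b - a + 2) * (M * exp (-(m / (2 * M))))) := by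
  have hM' : (1 : ℝ) ≤ M := by exact_mod_cast hM
  have hl1 : 1 / (M : ℝ) ≤ 1 := by rw [div_le_one (by linarith)]; exact hM'
  have hρ : 0 ≤ 1 - 1 / (M : ℝ) / 2 := by linarith
  have hbase : (1 - 1 / (M : ℝ) / 2) ^ m ≤ exp (-(m / (2 * M))) := by
    calc _ ≤ exp (-(1 / (M : ℝ) / 2)) ^ m := by
          gcongr
          linarith [Real.add_one_le_exp (-(1 / (M : ℝ) / 2))]
      _ = _ := by
        rw [← Real.exp_nat_mul]; congr 1; field_simp
  have h2 : 2 / N 0 ≤ 2 := by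
    rw [div_le_iff₀ (by linarith [hN 0])]; linarith [hN 0]
  calc _ ≤ volume (⋃ j ∈ Finset.range M, {x : ℝ | x ∈ Ico a b ∧ ∀ i < m, ∀ k : ℤ,
        N i * x - k ∉ Ico ((j : ℝ) / M) (j / M + 1 / M)}) := by
        apply measure_mono
        rintro x ⟨hx, j, hj, h⟩
        simp only [mem_iUnion]
        exact ⟨j, Finset.mem_range.2 hj, hx, h⟩
    _ ≤ ∑ j ∈ Finset.range M, volume {x : ℝ | x ∈ Ico a b ∧ ∀ i < m, ∀ k : ℤ,
        N i * x - k ∉ Ico ((j : ℝ) / M) (j / M + 1 / M)} := measure_biUnion_finset_le _ _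
    _ ≤ (Finset.range M).card • ENNReal.ofReal ((b - a + 2) * exp (-(m / (2 * M)))) := by
        refine Finset.sum_le_card_nsmul _ _ _ fun j _ => ?_
        refine (volume_avoid_arc_le _ (1 / (M : ℝ)) (by positivity) hl1 m N
          (fun i => by linarith [hN i]) (fun i => ?_) a b hab).trans ?_
        · simpa using hQ i
        · apply ENNReal.ofReal_le_ofReal
          have : 0 ≤ b - a := by linarith
          gcongr
    _ = _ := by
        rw [nsmul_eq_mul, Finset.card_range, ← ENNReal.ofReal_natCast,
          ← ENNReal.ofReal_mul (by positivity)]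
        congr 1; ring

lemma nint_sub_lt_of_mem_arc {M : ℕ} {y δ : ℝ} {k : ℤ}
    (h : y - k ∈ Ico ((⌊Int.fract δ * M⌋₊ : ℝ) / M) (⌊Int.fract δ * M⌋₊ / M + 1 / M))
    (hM : 0 < M) : nint (y - δ) < 1 / M := by
  have hM' : (0 : ℝ) < M := by exact_mod_cast hM
  have h1 : (⌊Int.fract δ * M⌋₊ : ℝ) / M ≤ Int.fract δ := by
    rw [div_le_iff₀ hM']
    exact Nat.floor_le (mul_nonneg (Int.fract_nonneg _) hM'.le)
  have h2 : Int.fract δ < ⌊Int.fract δ * M⌋₊ / M + 1 / M := by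
    rw [← add_div, lt_div_iff₀ hM']
    exact Nat.lt_floor_add_one _
  refine (nint_le_abs_sub _ (k - ⌊δ⌋)).trans_lt ?_
  have h3 : Int.fract δ = δ - ⌊δ⌋ := rfl
  rw [h3] at h1 h2
  rw [h3] at h
  push_cast
  rw [abs_lt]
  constructor <;> linarith [h.1, h.2]

lemma pow_mul_le_of_lacunary {n : ℕ → ℕ} {r : ℝ} (hr : 1 < r)
    (h : ∀ t, 1 ≤ t → r * n t ≤ n (t + 1)) {t : ℕ} (ht : 1 ≤ t) (s : ℕ) :
    r ^ s * n t ≤ n (t + s) := by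
  induction s with
  | zero => simp
  | succ s ih =>
    calc r ^ (s + 1) * n t = r * (r ^ s * n t) := by ring
      _ ≤ r * n (t + s) := by gcongr
      _ ≤ _ := h (t + s) (by omega)

/-- Number of arcs used at the dyadic scale `2 ^ k`. -/
noncomputable def arcCount (k : ℕ) : ℕ := ⌈8 * 2 ^ k / (k : ℝ) ^ 3⌉₊

lemma one_div_arcCount_le {k t : ℕ} (hk : 2 ≤ k) (h1 : 2 ^ k ≤ t) (h2 : t ≤ 2 * 2 ^ k)
    {ε : ℝ} (hε : 0 < ε) : 1 / (arcCount k : ℝ) ≤ log t ^ (3 + ε) / t := by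
  have hk' : (2 : ℝ) ≤ k := by exact_mod_cast hk
  have h1' : (2 : ℝ) ^ k ≤ t := by exact_mod_cast h1
  have h2' : (t : ℝ) ≤ 2 * 2 ^ k := by exact_mod_cast h2
  have ht : (0 : ℝ) < t := lt_of_lt_of_le (by positivity) h1'
  have hlog : k * (0.69 : ℝ) ≤ log t := by
    calc k * (0.69 : ℝ) ≤ k * log 2 := by gcongr; linarith [Real.log_two_gt_d9]
      _ = log (2 ^ k) := by rw [Real.log_pow]
      _ ≤ log t := Real.log_le_log (by positivity) h1'
  have hcube : (k : ℝ) ^ 3 / 4 ≤ log t ^ (3 + ε) := by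
    calc (k : ℝ) ^ 3 / 4 ≤ (k * 0.69) ^ 3 := by
          rw [mul_pow]; nlinarith [pow_pos (show (0 : ℝ) < k by linarith) 3]
      _ ≤ log t ^ 3 := by gcongr
      _ = log t ^ (3 : ℝ) := by norm_cast
      _ ≤ _ := Real.rpow_le_rpow_of_exponent_le (by linarith) (by linarith)
  calc 1 / (arcCount k : ℝ) ≤ 1 / (8 * 2 ^ k / (k : ℝ) ^ 3) := by
        gcongr
        exact Nat.le_ceil _
    _ = (k : ℝ) ^ 3 / 4 / (2 * 2 ^ k) := by field_simp; norm_num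
    _ ≤ _ := by gcongr

lemma arcCount_mul_exp_le {C k : ℕ} (hC : 1 ≤ C) (hk : 128 * C ≤ k)
    (hk3 : (k : ℝ) ^ 3 ≤ 2 ^ k) (hCk : C * k ≤ 2 ^ k) :
    0 < arcCount k ∧ arcCount k ≤ 2 ^ k ∧
      arcCount k * exp (-((2 ^ k / (C * k) : ℕ) / (2 * arcCount k))) ≤ exp (-1) ^ k := by
  have hC' : (1 : ℝ) ≤ C := by exact_mod_cast hC
  have hk' : 128 * (C : ℝ) ≤ k := by exact_mod_cast hk
  have hk0 : (0 : ℝ) < k := by linarith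
  have hx : 0 < 8 * 2 ^ k / (k : ℝ) ^ 3 := by positivity
  have hpos : 0 < arcCount k := Nat.ceil_pos.2 hx
  have hposR : (0 : ℝ) < arcCount k := by exact_mod_cast hpos
  have hle : arcCount k ≤ 2 ^ k := by
    apply Nat.ceil_le.2
    push_cast
    rw [div_le_iff₀ (by positivity), mul_comm]
    gcongr
    calc (8 : ℝ) = 2 ^ 3 := by norm_num
      _ ≤ (k : ℝ) ^ 3 := by gcongr; linarith
  have hleR : (arcCount k : ℝ) ≤ 2 ^ k := by exact_mod_cast hle
  have hle16 : (arcCount k : ℝ) ≤ 16 * 2 ^ k / (k : ℝ) ^ 3 := by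
    have h1 : (1 : ℝ) ≤ 2 ^ k / (k : ℝ) ^ 3 := by rwa [one_le_div (by positivity)]
    have h2 : (arcCount k : ℝ) < 8 * 2 ^ k / (k : ℝ) ^ 3 + 1 := Nat.ceil_lt_add_one hx.le
    have h3 : 8 * 2 ^ k / (k : ℝ) ^ 3 = 8 * (2 ^ k / (k : ℝ) ^ 3) := by ring
    have h4 : 16 * 2 ^ k / (k : ℝ) ^ 3 = 16 * (2 ^ k / (k : ℝ) ^ 3) := by ring
    linarith
  have hm : (2 : ℝ) ^ k / (2 * C * k) ≤ (2 ^ k / (C * k) : ℕ) := by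
    have hCk0 : 0 < C * k := Nat.mul_pos (by omega) (by omega)
    have h1 : 1 ≤ 2 ^ k / (C * k) := (Nat.one_le_div_iff hCk0).2 hCk
    have h2 : 2 ^ k < C * k * (2 ^ k / (C * k) + 1) := Nat.lt_mul_div_succ _ hCk0
    have h1' : (1 : ℝ) ≤ (2 ^ k / (C * k) : ℕ) := by exact_mod_cast h1
    have h2' : (2 : ℝ) ^ k < C * k * ((2 ^ k / (C * k) : ℕ) + 1) := by exact_mod_cast h2
    rw [div_le_iff₀ (by positivity)]
    have : (0 : ℝ) < C * k := by positivity
    nlinarith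
  have hexp : 2 * (k : ℝ) ≤ (2 ^ k / (C * k) : ℕ) / (2 * arcCount k) := by
    calc 2 * (k : ℝ) ≤ k * k / (64 * C) := by
          rw [le_div_iff₀ (by positivity)]; nlinarith
      _ = 2 ^ k / (2 * C * k) / (2 * (16 * 2 ^ k / (k : ℝ) ^ 3)) := by field_simp; norm_num
      _ ≤ _ := by gcongr
  refine ⟨hpos, hle, ?_⟩
  calc _ ≤ 2 ^ k * exp (-(2 * (k : ℝ))) := by gcongr
    _ ≤ exp 1 ^ k * exp (-(2 * (k : ℝ))) := by
      gcongr
      linarith [Real.add_one_le_exp 1]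
    _ = _ := by
      rw [← Real.exp_nat_mul, ← Real.exp_nat_mul, ← Real.exp_add]
      congr 1; ring

lemma eventually_scale_large (C : ℕ) : ∀ᶠ k : ℕ in Filter.atTop,
    128 * C ≤ k ∧ (k : ℝ) ^ 3 ≤ 2 ^ k ∧ C * k ≤ 2 ^ k := by
  have hcube : ∀ᶠ k : ℕ in Filter.atTop, (k : ℝ) ^ 3 ≤ 2 ^ k := by
    have := (isLittleO_pow_const_const_pow_of_one_lt (R := ℝ) 3 (r := 2) (by norm_num)).bound
      one_pos
    filter_upwards [this] with k hk
    simpa using hk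
  filter_upwards [hcube, Filter.eventually_ge_atTop (128 * C), Filter.eventually_ge_atTop 1]
    with k h3 hk h1
  refine ⟨hk, h3, ?_⟩
  have h3' : k ^ 3 ≤ 2 ^ k := by exact_mod_cast h3
  calc C * k ≤ k * k := Nat.mul_le_mul_right _ (by omega)
    _ = k ^ 2 := by ring
    _ ≤ k ^ 3 := Nat.pow_le_pow_right h1 (by norm_num)
    _ ≤ _ := h3'

theorem lacunary_leb_ae (n : ℕ → ℕ) (hpos : ∀ t, 1 ≤ t → 0 < n t)
    (hlac : ∃ r : ℝ, 1 < r ∧ ∀ t, 1 ≤ t → r * n t ≤ n (t + 1))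
    (ε : ℝ) (hε : 0 < ε) :
    ∀ᵐ β ∂(volume : Measure ℝ), ∀ δ : ℝ,
      Set.Infinite {t : ℕ | 0 < t ∧ nint ((n t : ℝ) * β - δ) < Real.log t ^ ((3 : ℝ) + ε) / t} := by
  obtain ⟨r, hr, hlac⟩ := hlac
  obtain ⟨C, hC⟩ := pow_unbounded_of_one_lt 4 hr
  have hC1 : 1 ≤ C := by
    by_contra h
    rw [show C = 0 by omega] at hC
    norm_num at hC
  obtain ⟨k₀, hk₀⟩ := Filter.eventually_atTop.1 (eventually_scale_large C)
  let bad : ℕ → ℝ → Prop := fun k x => ∃ j < arcCount k, ∀ i < 2 ^ k / (C * k), ∀ z : ℤ,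
    (n (2 ^ k + i * (C * k)) : ℝ) * x - z ∉
      Ico ((j : ℝ) / arcCount k) (j / arcCount k + 1 / arcCount k)
  have hbad : ∀ A : ℕ, ∀ k ≥ k₀, volume {x : ℝ | x ∈ Ico (-(A : ℝ)) A ∧ bad k x} ≤
      ENNReal.ofReal ((A - -(A : ℝ) + 2) * exp (-1) ^ k) := by
    intro A k hk
    obtain ⟨h128, h3, hCk⟩ := hk₀ k hk
    obtain ⟨hM, hM2, hexp⟩ := arcCount_mul_exp_le hC1 h128 h3 hCk
    have hA : (0 : ℝ) ≤ A := A.cast_nonneg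
    have hone : ∀ i, 1 ≤ 2 ^ k + i * (C * k) := fun i =>
      Nat.one_le_two_pow.trans (Nat.le_add_right (2 ^ k) _)
    refine (volume_exists_avoid_arc_le (arcCount k) (2 ^ k / (C * k)) hM
      (fun i => (n (2 ^ k + i * (C * k)) : ℝ)) (fun i => ?_) (fun i => ?_) _ _
      (by linarith)).trans ?_
    · exact_mod_cast hpos _ (hone i)
    · have hrat : 4 * (arcCount k : ℝ) ≤ r ^ (C * k) := by
        have hk2 : 2 ≤ k := by omega
        have hMR : (arcCount k : ℝ) ≤ 2 ^ k := by exact_mod_cast hM2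
        calc 4 * (arcCount k : ℝ) ≤ 2 ^ 2 * 2 ^ k := by norm_num; exact hMR
          _ ≤ 2 ^ k * 2 ^ k := by gcongr; norm_num
          _ = 4 ^ k := by rw [← mul_pow]; norm_num
          _ ≤ (r ^ C) ^ k := by gcongr
          _ = _ := (pow_mul _ _ _).symm
      have := pow_mul_le_of_lacunary hr hlac (hone i) (C * k)
      rw [show 2 ^ k + (i + 1) * (C * k) = 2 ^ k + i * (C * k) + C * k by ring]
      refine le_trans ?_ this
      gcongr
    · exact ENNReal.ofReal_le_ofReal (mul_le_mul_of_nonneg_left hexp (by linarith))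
  have hBC : ∀ A : ℕ, ∀ᵐ x : ℝ, ∀ᶠ k in Filter.atTop,
      ¬ (k₀ ≤ k ∧ x ∈ Ico (-(A : ℝ)) A ∧ bad k x) := by
    intro A
    have hA : (0 : ℝ) ≤ A := A.cast_nonneg
    have hsum : Summable fun k : ℕ => (A - -(A : ℝ) + 2) * exp (-1) ^ k :=
      (summable_geometric_of_lt_one (Real.exp_pos _).le
        (by simp)).mul_left _
    apply ae_eventually_notMem
      (s := fun k => {x | k₀ ≤ k ∧ x ∈ Ico (-(A : ℝ)) A ∧ bad k x})
    refine ne_top_of_le_ne_top hsum.tsum_ofReal_ne_top (ENNReal.tsum_le_tsum fun k => ?_)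
    by_cases hk : k₀ ≤ k
    · exact (measure_mono fun x hx => hx.2).trans (hbad A k hk)
    · simp [hk]
  filter_upwards [ae_all_iff.2 hBC] with β hβ δ
  obtain ⟨A, hA⟩ := exists_nat_gt |β|
  obtain ⟨k₁, hk₁⟩ := Filter.eventually_atTop.1 (hβ A)
  refine Set.infinite_of_forall_exists_gt fun T => ?_
  obtain ⟨k, hkT, hk1, hk0, hk2⟩ : ∃ k, T ≤ k ∧ k₁ ≤ k ∧ k₀ ≤ k ∧ 2 ≤ k :=
    ⟨T + k₁ + k₀ + 2, by omega, by omega, by omega, by omega⟩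
  obtain ⟨h128, h3, hCk⟩ := hk₀ k hk0
  obtain ⟨hM, -, -⟩ := arcCount_mul_exp_le hC1 h128 h3 hCk
  have hgood : ¬ bad k β := fun h =>
    hk₁ k hk1 ⟨hk0, ⟨by linarith [(abs_lt.1 hA).1], (abs_lt.1 hA).2⟩, h⟩
  have hMR : (0 : ℝ) < arcCount k := by exact_mod_cast hM
  have hj : ⌊Int.fract δ * arcCount k⌋₊ < arcCount k := by
    rw [Nat.floor_lt (mul_nonneg (Int.fract_nonneg _) hMR.le)]
    nlinarith [Int.fract_lt_one δ]
  simp only [bad] at hgood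
  push Not at hgood
  obtain ⟨i, hi, z, hz⟩ := hgood _ hj
  have hup : i * (C * k) ≤ 2 ^ k :=
    (Nat.mul_le_mul_right _ hi.le).trans (Nat.div_mul_le_self _ _)
  have hTk : T < 2 ^ k := hkT.trans_lt Nat.lt_two_pow_self
  have ht0 : 0 < 2 ^ k + i * (C * k) := by omega
  exact ⟨2 ^ k + i * (C * k), ⟨ht0, (nint_sub_lt_of_mem_arc hz hM).trans_le
    (one_div_arcCount_le hk2 (by omega) (by omega) hε)⟩, by omega⟩
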